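/- Let f ∈ C^s(T²), s ≥ 2, have mean value 0 and not be identically zero. Then the supremum over all closed geodesics γ of (1/|γ|)|∫_γ f dH¹| is attained by some closed geodesic γ, and moreover any attaining geodesic satisfies |γ|^s ≤ C_s · (max_{|α|=s}‖∂_α f‖_{L¹(T²)}) · ‖∇f‖_{L²} · ‖f‖_{L²}^{−2}, with C_s depending only on s. -/

import Mathlib

open MeasureTheory

/-- A function on `ℝ²` that is `ℤ²`-periodic, i.e. a function on the torus `T²`. -/
def Periodic2 (f : ℝ × ℝ → ℂ) : Prop :=
  ∀ x y : ℝ, f (x + 1, y) = f (x, y) ∧ f (x, y + 1) = f (x, y)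

/-- The Fourier coefficient `f̂(k) = ∫_{[0,1]²} f(x,y) e^{-2πi(k₁x + k₂y)}`. -/
noncomputable def fc (f : ℝ × ℝ → ℂ) (k : ℤ × ℤ) : ℂ :=
  ∫ x in (0:ℝ)..1, ∫ y in (0:ℝ)..1,
    f (x, y) * Complex.exp (-2 * (Real.pi : ℂ) * Complex.I * ((k.1 : ℂ) * x + (k.2 : ℂ) * y))

/-- The average of `f` over the closed geodesic `γ(t) = (a t, b t + c)`, `t ∈ [0,1]`:
`(1/|γ|) ∫_γ f dH¹ = ∫₀¹ f(γ(t)) dt`. -/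
noncomputable def geodAvg (f : ℝ × ℝ → ℂ) (a b : ℤ) (c : ℝ) : ℂ :=
  ∫ t in (0:ℝ)..1, f ((a : ℝ) * t, (b : ℝ) * t + c)

/-- The average of `f` over the general closed geodesic `γ(t) = p + t (a,b)`, `t ∈ [0,1]`. -/
noncomputable def geodAvgP (f : ℝ × ℝ → ℂ) (a b : ℤ) (p : ℝ × ℝ) : ℂ :=
  ∫ t in (0:ℝ)..1, f (p.1 + (a : ℝ) * t, p.2 + (b : ℝ) * t)

/-- The squared `L²(T²)` norm of `f`. -/
noncomputable def L2sq (f : ℝ × ℝ → ℂ) : ℝ :=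
  ∫ x in (0:ℝ)..1, ∫ y in (0:ℝ)..1, ‖f (x, y)‖ ^ 2

/-- The `L¹(T²)` norm of `f`. -/
noncomputable def L1norm (f : ℝ × ℝ → ℂ) : ℝ :=
  ∫ x in (0:ℝ)..1, ∫ y in (0:ℝ)..1, ‖f (x, y)‖

/-- Partial derivative in the first variable. -/
noncomputable def pd1 (f : ℝ × ℝ → ℂ) : ℝ × ℝ → ℂ :=
  fun v => deriv (fun x => f (x, v.2)) v.1

/-- Partial derivative in the second variable. -/
noncomputable def pd2 (f : ℝ × ℝ → ℂ) : ℝ × ℝ → ℂ :=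
  fun v => deriv (fun y => f (v.1, y)) v.2

/-- The mixed partial derivative `∂_α f` for the multi-index `α = (α₁, α₂)`. -/
noncomputable def pdMix (a1 a2 : ℕ) (f : ℝ × ℝ → ℂ) : ℝ × ℝ → ℂ :=
  pd1^[a1] (pd2^[a2] f)

/-- The squared `L²(T²)` norm of `∇f`. -/
noncomputable def gradL2sq (f : ℝ × ℝ → ℂ) : ℝ :=
  ∫ x in (0:ℝ)..1, ∫ y in (0:ℝ)..1, (‖pd1 f (x, y)‖ ^ 2 + ‖pd2 f (x, y)‖ ^ 2)

/-- The set of absolute average values of `f` over all closed geodesics of `T²`. -/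
def geodVals (f : ℝ × ℝ → ℂ) : Set ℝ :=
  {v : ℝ | ∃ (a b : ℤ) (p : ℝ × ℝ), Int.gcd a b = 1 ∧ v = ‖geodAvgP f a b p‖}

/-- The one-dimensional character `x ↦ e^{-2πinx}`. -/
noncomputable def expNeg (n : ℤ) (x : ℝ) : ℂ :=
  Complex.exp (-2 * (Real.pi : ℂ) * Complex.I * ((n : ℂ) * x))

lemma continuous_expNeg (n : ℤ) : Continuous (expNeg n) := by
  unfold expNeg; fun_prop

lemma norm_expNeg (n : ℤ) (x : ℝ) : ‖expNeg n x‖ = 1 := by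
  rw [expNeg, Complex.norm_exp]
  simp

lemma expNeg_add (n : ℤ) (x y : ℝ) : expNeg n (x + y) = expNeg n x * expNeg n y := by
  simp only [expNeg, ← Complex.exp_add]
  congr 1
  push_cast
  ring

lemma expNeg_one (n : ℤ) : expNeg n 1 = 1 := by
  rw [expNeg, Complex.exp_eq_one_iff]
  exact ⟨-n, by push_cast; ring⟩

lemma fourierCoeffOn_eq_expNeg (g : ℝ → ℂ) (n : ℤ) :
    fourierCoeffOn zero_lt_one g n = ∫ x in (0 : ℝ)..1, expNeg n x * g x := by
  rw [fourierCoeffOn_eq_integral]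
  simp only [sub_zero, one_div, inv_one, one_smul, smul_eq_mul]
  refine intervalIntegral.integral_congr fun x _ => ?_
  simp only [expNeg]
  rw [fourier_coe_apply]
  congr 2
  push_cast
  ring

lemma memLp_two_of_continuous {g : ℝ → ℂ} (hg : Continuous g) :
    MemLp g 2 (volume.restrict (Set.Ioc (0 : ℝ) 1)) := by
  obtain ⟨B, hB⟩ := (isCompact_Icc (a := (0 : ℝ)) (b := 1)).exists_bound_of_continuousOn
    hg.continuousOn
  refine MemLp.of_bound hg.aestronglyMeasurable B ?_
  exact (ae_restrict_iff' measurableSet_Ioc).2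
    (Filter.Eventually.of_forall fun x hx => hB x (Set.Ioc_subset_Icc_self hx))

lemma hasSum_sq_fourierCoeffOn_of_continuous {g : ℝ → ℂ} (hg : Continuous g) :
    HasSum (fun n => ‖fourierCoeffOn zero_lt_one g n‖ ^ 2) (∫ x in (0 : ℝ)..1, ‖g x‖ ^ 2) := by
  simpa using hasSum_sq_fourierCoeffOn zero_lt_one (memLp_two_of_continuous hg)

/-- Bessel's inequality. -/
lemma sum_sq_fourierCoeffOn_le {g : ℝ → ℂ} (hg : Continuous g) (s : Finset ℤ) :
    ∑ n ∈ s, ‖fourierCoeffOn zero_lt_one g n‖ ^ 2 ≤ ∫ x in (0 : ℝ)..1, ‖g x‖ ^ 2 :=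
  sum_le_hasSum s (fun _ _ => sq_nonneg _) (hasSum_sq_fourierCoeffOn_of_continuous hg)

lemma norm_fourierCoeffOn_deriv {g g' : ℝ → ℂ} (hg : ∀ x, HasDerivAt g (g' x) x)
    (hg' : Continuous g') (hper : g 1 = g 0) {n : ℤ} (hn : n ≠ 0) :
    ‖fourierCoeffOn zero_lt_one g n‖ * (2 * Real.pi * |(n : ℝ)|) =
      ‖fourierCoeffOn zero_lt_one g' n‖ := by
  have h := fourierCoeffOn_of_hasDerivAt zero_lt_one hn (fun x _ => hg x)
    (hg'.intervalIntegrable 0 1)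
  have hn' : |(n : ℝ)| ≠ 0 := by simpa using hn
  have hpi := Real.pi_pos
  rw [h, hper]
  simp only [sub_self, mul_zero, Complex.ofReal_one, Complex.ofReal_zero, sub_zero, zero_sub,
    one_mul, norm_mul, norm_div, norm_neg, norm_one, Complex.norm_I, Complex.norm_real,
    Complex.norm_intCast, Real.norm_eq_abs, abs_of_pos hpi, Complex.norm_ofNat]
  field_simp

/-- Parseval's identity with the high frequencies controlled by the derivative. -/
lemma integral_sq_le_sum_add {g g' : ℝ → ℂ} (hg : ∀ x, HasDerivAt g (g' x) x)
    (hg' : Continuous g') (hper : g 1 = g 0) (N : ℕ) :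
    ∫ x in (0 : ℝ)..1, ‖g x‖ ^ 2 ≤
      ∑ n ∈ Finset.Icc (-(N : ℤ)) N, ‖fourierCoeffOn zero_lt_one g n‖ ^ 2 +
        (4 * Real.pi ^ 2 * (N + 1) ^ 2)⁻¹ * ∫ x in (0 : ℝ)..1, ‖g' x‖ ^ 2 := by
  have hgc : Continuous g := continuous_iff_continuousAt.2 fun x => (hg x).continuousAt
  have hpi := Real.pi_pos
  have hlow : HasSum (fun n => if n ∈ Finset.Icc (-(N : ℤ)) N then
      ‖fourierCoeffOn zero_lt_one g n‖ ^ 2 else 0)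
      (∑ n ∈ Finset.Icc (-(N : ℤ)) N, ‖fourierCoeffOn zero_lt_one g n‖ ^ 2) := by
    rw [← Finset.sum_congr rfl (fun n hn => if_pos hn)]
    exact hasSum_sum_of_ne_finset_zero fun n hn => if_neg hn
  refine hasSum_le (fun n => ?_) (hasSum_sq_fourierCoeffOn_of_continuous hgc)
    (hlow.add ((hasSum_sq_fourierCoeffOn_of_continuous hg').mul_left _))
  split_ifs with hn
  · exact le_add_of_nonneg_right (by positivity)
  · have hN : (N : ℝ) + 1 ≤ |(n : ℝ)| := by
      have : (N : ℤ) + 1 ≤ |n| := by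
        rw [Finset.mem_Icc, ← abs_le] at hn
        omega
      exact_mod_cast this
    have hn0 : n ≠ 0 := by
      rintro rfl
      simp at hn
    rw [zero_add, ← norm_fourierCoeffOn_deriv hg hg' hper hn0, inv_mul_eq_div,
      le_div_iff₀ (by positivity), mul_pow]
    gcongr
    have := mul_le_mul hN hN (by positivity) (by positivity)
    nlinarith [sq_nonneg Real.pi]

lemma integral_integral_swap_of_continuous {E : Type*} [NormedAddCommGroup E] [NormedSpace ℝ E]
    {Φ : ℝ → ℝ → E} (hΦ : Continuous Φ.uncurry) (a b c d : ℝ) :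
    ∫ x in a..b, ∫ y in c..d, Φ x y = ∫ y in c..d, ∫ x in a..b, Φ x y :=
  intervalIntegral_intervalIntegral_swap <|
    (hΦ.continuousOn.integrableOn_compact (isCompact_uIcc.prod isCompact_uIcc)).mono_set
      (Set.prod_mono Set.uIoc_subset_uIcc Set.uIoc_subset_uIcc)

/-- Differentiation under the integral sign. -/
lemma hasDerivAt_integral_of_continuous {Φ Φ' : ℝ → ℝ → ℂ} (hΦ : Continuous Φ.uncurry)
    (hΦ' : Continuous Φ'.uncurry) (hd : ∀ t c, HasDerivAt (fun c => Φ c t) (Φ' c t) c) (c : ℝ) :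
    HasDerivAt (fun c => ∫ t in (0 : ℝ)..1, Φ c t) (∫ t in (0 : ℝ)..1, Φ' c t) c := by
  have hcont : Continuous fun u => ∫ t in (0 : ℝ)..1, Φ' u t :=
    intervalIntegral.continuous_parametric_intervalIntegral_of_continuous' hΦ' 0 1
  have hcol : ∀ c, Continuous (Φ c) := fun c => hΦ.comp (by fun_prop : Continuous fun t => (c, t))
  have key : (fun c => ∫ t in (0 : ℝ)..1, Φ c t) =
      fun c => (∫ t in (0 : ℝ)..1, Φ 0 t) + ∫ u in (0 : ℝ)..c, ∫ t in (0 : ℝ)..1, Φ' u t := by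
    funext c
    rw [integral_integral_swap_of_continuous hΦ', ← intervalIntegral.integral_add
      ((hcol 0).intervalIntegrable _ _) (Continuous.intervalIntegrable (by fun_prop) _ _)]
    refine intervalIntegral.integral_congr fun t _ => ?_
    have hrow : Continuous fun u => Φ' u t :=
      hΦ'.comp (by fun_prop : Continuous fun u => (u, t))
    simp only [intervalIntegral.integral_eq_sub_of_hasDerivAt (fun u _ => hd t u)
      (hrow.intervalIntegrable 0 c)]
    ring
  rw [key]
  exact (intervalIntegral.integral_hasDerivAt_right (hcont.intervalIntegrable _ _)
    (hcont.stronglyMeasurableAtFilter _ _) hcont.continuousAt).const_add _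

lemma hasDerivAt_fderiv_snd {F : ℝ × ℝ → ℂ} (hF : Differentiable ℝ F) (x y : ℝ) :
    HasDerivAt (fun y => F (x, y)) (fderiv ℝ F (x, y) (0, 1)) y :=
  (hF (x, y)).hasFDerivAt.comp_hasDerivAt y ((hasDerivAt_const y x).prodMk (hasDerivAt_id y))

lemma pd2_eq_fderiv {F : ℝ × ℝ → ℂ} (hF : Differentiable ℝ F) :
    pd2 F = fun v => fderiv ℝ F v (0, 1) :=
  funext fun v => (hasDerivAt_fderiv_snd hF v.1 v.2).deriv

lemma hasDerivAt_pd2 {F : ℝ × ℝ → ℂ} (hF : Differentiable ℝ F) (x y : ℝ) :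
    HasDerivAt (fun y => F (x, y)) (pd2 F (x, y)) y :=
  (hasDerivAt_fderiv_snd hF x y).differentiableAt.hasDerivAt

lemma contDiff_pd2 {F : ℝ × ℝ → ℂ} {n : ℕ} (hF : ContDiff ℝ (n + 1 : ℕ) F) :
    ContDiff ℝ n (pd2 F) := by
  rw [pd2_eq_fderiv (hF.differentiable (by simp))]
  exact (hF.fderiv_right (by simp)).clm_apply contDiff_const

lemma Periodic2.swap {F : ℝ × ℝ → ℂ} (hF : Periodic2 F) : Periodic2 (F ∘ Prod.swap) :=
  fun x y => ⟨(hF y x).2, (hF y x).1⟩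

lemma Periodic2.pd2 {F : ℝ × ℝ → ℂ} (hF : Periodic2 F) : Periodic2 (pd2 F) := by
  intro x y
  constructor
  · simp only [_root_.pd2]
    congr 1
    exact funext fun y => (hF x y).1
  · simp only [_root_.pd2]
    rw [← deriv_comp_add_const]
    congr 1
    exact funext fun y => (hF x y).2

lemma ContDiff.comp_swap {F : ℝ × ℝ → ℂ} {n : WithTop ℕ∞} (hF : ContDiff ℝ n F) :
    ContDiff ℝ n (F ∘ Prod.swap) :=
  hF.comp (contDiff_snd.prodMk contDiff_fst)

lemma continuous_pd1 {F : ℝ × ℝ → ℂ} (hF : ContDiff ℝ 1 F) : Continuous (pd1 F) :=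
  (contDiff_pd2 (F := F ∘ Prod.swap) (n := 0) (by simpa using hF.comp_swap)).continuous.comp
    continuous_swap

lemma hasDerivAt_pd1 {F : ℝ × ℝ → ℂ} (hF : Differentiable ℝ F) (x y : ℝ) :
    HasDerivAt (fun x => F (x, y)) (pd1 F (x, y)) x :=
  hasDerivAt_pd2 (F := F ∘ Prod.swap) (hF.comp (differentiable_snd.prodMk differentiable_fst)) y x

lemma fourierCoeffOn_fourierCoeffOn (F : ℝ × ℝ → ℂ) (n m : ℤ) :
    fourierCoeffOn zero_lt_one (fun x => fourierCoeffOn zero_lt_one (fun y => F (x, y)) m) n =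
      fc F (n, m) := by
  simp only [fourierCoeffOn_eq_expNeg, fc, ← intervalIntegral.integral_const_mul]
  refine intervalIntegral.integral_congr fun x _ => intervalIntegral.integral_congr fun y _ => ?_
  simp only [expNeg, mul_add, Complex.exp_add]
  ring

lemma L2sq_le_sum_add {F : ℝ × ℝ → ℂ} (hper : Periodic2 F) (hF : ContDiff ℝ 1 F) (N : ℕ) :
    L2sq F ≤ ∑ m ∈ Finset.Icc (-(N : ℤ)) N, ∑ n ∈ Finset.Icc (-(N : ℤ)) N, ‖fc F (n, m)‖ ^ 2 +
      (4 * Real.pi ^ 2 * (N + 1) ^ 2)⁻¹ * gradL2sq F := by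
  set κ : ℝ := (4 * Real.pi ^ 2 * (N + 1) ^ 2)⁻¹
  have hκ : 0 ≤ κ := by positivity
  have hFc := hF.continuous
  have hd1 := hasDerivAt_pd1 (hF.differentiable (by simp))
  have hd2 := hasDerivAt_pd2 (hF.differentiable (by simp))
  have hc1 := continuous_pd1 hF
  have hc2 : Continuous (pd2 F) := (contDiff_pd2 (n := 0) (by simpa using hF)).continuous
  set φ : ℤ → ℝ → ℂ := fun m x => fourierCoeffOn zero_lt_one (fun y => F (x, y)) m with hφ
  set φ' : ℤ → ℝ → ℂ := fun m x => fourierCoeffOn zero_lt_one (fun y => pd1 F (x, y)) m with hφ'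
  have hφ'c : ∀ m, Continuous (φ' m) := by
    intro m
    have := continuous_expNeg m
    simp only [hφ', fourierCoeffOn_eq_expNeg]
    fun_prop
  have hφd : ∀ m x, HasDerivAt (φ m) (φ' m x) x := by
    intro m x
    have := continuous_expNeg m
    simp only [hφ, hφ', fourierCoeffOn_eq_expNeg]
    refine hasDerivAt_integral_of_continuous (Φ := fun x y => expNeg m y * F (x, y))
      (Φ' := fun x y => expNeg m y * pd1 F (x, y)) (by fun_prop) (by fun_prop) ?_ x
    exact fun y x => (hd1 x y).const_mul _
  have hφc : ∀ m, Continuous (φ m) := fun m =>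
    continuous_iff_continuousAt.2 fun x => (hφd m x).continuousAt
  have hφper : ∀ m, φ m 1 = φ m 0 := by
    intro m
    simp only [hφ]
    congr 1
    funext y
    simpa using (hper 0 y).1
  have hint : ∀ {g : ℝ → ℝ}, Continuous g → IntervalIntegrable g volume 0 1 :=
    fun hg => hg.intervalIntegrable 0 1
  calc L2sq F ≤ ∫ x in (0 : ℝ)..1, (∑ m ∈ Finset.Icc (-(N : ℤ)) N, ‖φ m x‖ ^ 2 +
        κ * ∫ y in (0 : ℝ)..1, ‖pd2 F (x, y)‖ ^ 2) := by
        refine intervalIntegral.integral_mono_on zero_le_one (hint (by fun_prop))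
          (hint (by fun_prop)) fun x _ => ?_
        exact integral_sq_le_sum_add (fun y => hd2 x y) (by fun_prop)
          (by simpa using (hper x 0).2) N
    _ = ∑ m ∈ Finset.Icc (-(N : ℤ)) N, (∫ x in (0 : ℝ)..1, ‖φ m x‖ ^ 2) +
        κ * ∫ x in (0 : ℝ)..1, ∫ y in (0 : ℝ)..1, ‖pd2 F (x, y)‖ ^ 2 := by
        rw [intervalIntegral.integral_add (hint (by fun_prop)) (hint (by fun_prop)),
          intervalIntegral.integral_finsetSum (fun m _ => hint (by fun_prop)),
          intervalIntegral.integral_const_mul]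
    _ ≤ ∑ m ∈ Finset.Icc (-(N : ℤ)) N, (∑ n ∈ Finset.Icc (-(N : ℤ)) N, ‖fc F (n, m)‖ ^ 2 +
          κ * ∫ x in (0 : ℝ)..1, ‖φ' m x‖ ^ 2) +
        κ * ∫ x in (0 : ℝ)..1, ∫ y in (0 : ℝ)..1, ‖pd2 F (x, y)‖ ^ 2 := by
        gcongr with m _
        simpa only [← fourierCoeffOn_fourierCoeffOn] using
          integral_sq_le_sum_add (hφd m) (hφ'c m) (hφper m) N
    _ = ∑ m ∈ Finset.Icc (-(N : ℤ)) N, ∑ n ∈ Finset.Icc (-(N : ℤ)) N, ‖fc F (n, m)‖ ^ 2 +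
          κ * ((∫ x in (0 : ℝ)..1, ∑ m ∈ Finset.Icc (-(N : ℤ)) N, ‖φ' m x‖ ^ 2) +
          ∫ x in (0 : ℝ)..1, ∫ y in (0 : ℝ)..1, ‖pd2 F (x, y)‖ ^ 2) := by
        rw [Finset.sum_add_distrib, ← Finset.mul_sum,
          intervalIntegral.integral_finsetSum (fun m _ => hint (by fun_prop))]
        ring
    _ ≤ ∑ m ∈ Finset.Icc (-(N : ℤ)) N, ∑ n ∈ Finset.Icc (-(N : ℤ)) N, ‖fc F (n, m)‖ ^ 2 +
          κ * ((∫ x in (0 : ℝ)..1, ∫ y in (0 : ℝ)..1, ‖pd1 F (x, y)‖ ^ 2) +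
          ∫ x in (0 : ℝ)..1, ∫ y in (0 : ℝ)..1, ‖pd2 F (x, y)‖ ^ 2) := by
        gcongr
        refine intervalIntegral.integral_mono_on zero_le_one (hint (by fun_prop))
          (hint (by fun_prop)) fun x _ => ?_
        exact sum_sq_fourierCoeffOn_le (by fun_prop) _
    _ = _ := by
        rw [gradL2sq, ← intervalIntegral.integral_add (hint (by fun_prop)) (hint (by fun_prop))]
        congr 2
        refine intervalIntegral.integral_congr fun x _ => ?_
        exact (intervalIntegral.integral_add (hint (by fun_prop)) (hint (by fun_prop))).symm

lemma norm_le_integral_norm_deriv {H H' : ℝ → ℂ} (hd : ∀ x, HasDerivAt H (H' x) x)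
    (hH' : Continuous H') {P : ℝ} (hP : 0 < P) (c : ℝ) (hmean : ∫ x in c..c + P, H x = 0) :
    ‖H c‖ ≤ ∫ x in c..c + P, ‖H' x‖ := by
  have hH : Continuous H := continuous_iff_continuousAt.2 fun x => (hd x).continuousAt
  have hosc : ∀ x ∈ Set.uIoc c (c + P), ‖H x - H c‖ ≤ ∫ x in c..c + P, ‖H' x‖ := by
    intro x hx
    rw [Set.uIoc_of_le (by linarith)] at hx
    rw [← intervalIntegral.integral_eq_sub_of_hasDerivAt (fun u _ => hd u)
      (hH'.intervalIntegrable c x)]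
    refine (intervalIntegral.norm_integral_le_integral_norm hx.1.le).trans ?_
    exact intervalIntegral.integral_mono_interval le_rfl hx.1.le hx.2
      (Filter.Eventually.of_forall fun _ => norm_nonneg _) (hH'.norm.intervalIntegrable _ _)
  have h := intervalIntegral.norm_integral_le_of_norm_le_const hosc
  rw [intervalIntegral.integral_sub (hH.intervalIntegrable _ _) intervalIntegrable_const, hmean,
    intervalIntegral.integral_const, add_sub_cancel_left, zero_sub, norm_neg, norm_smul,
    Real.norm_eq_abs, mul_comm] at h
  exact le_of_mul_le_mul_right h (abs_pos.2 hP.ne')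

/-- A mean-zero periodic function is bounded by the `L¹` norm of any of its derivatives over a
period, with a power of the period gained for each extra derivative. -/
lemma norm_le_pow_mul_integral_norm_iterated_deriv {P : ℝ} (hP : 0 < P) (n : ℕ) :
    ∀ H : ℕ → ℝ → ℂ, (∀ j ≤ n, ∀ x, HasDerivAt (H j) (H (j + 1) x) x) →
      (∀ j ≤ n + 1, Continuous (H j)) → (∀ j ≤ n + 1, Function.Periodic (H j) P) →
      (∫ x in (0 : ℝ)..0 + P, H 0 x = 0) →
      ∀ c, ‖H 0 c‖ ≤ P ^ n * ∫ x in (0 : ℝ)..0 + P, ‖H (n + 1) x‖ := by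
  induction n with
  | zero =>
    intro H hd hc hper hmean c
    rw [pow_zero, one_mul,
      (show Function.Periodic (fun x => ‖H (0 + 1) x‖) P from fun x => by
        simp only [hper _ le_rfl x]).intervalIntegral_add_eq 0 c]
    refine norm_le_integral_norm_deriv (hd 0 le_rfl) (hc 1 le_rfl) hP c ?_
    rw [← (hper 0 (by omega)).intervalIntegral_add_eq 0 c, hmean]
  | succ n ih =>
    intro H hd hc hper hmean c
    have h1 := ih (fun j => H (j + 1)) (fun j hj => hd (j + 1) (by omega))
      (fun j hj => hc (j + 1) (by omega)) (fun j hj => hper (j + 1) (by omega)) (by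
        rw [intervalIntegral.integral_eq_sub_of_hasDerivAt (fun x _ => hd 0 (by omega) x)
          ((hc 1 (by omega)).intervalIntegrable _ _), hper 0 (by omega) 0, sub_self])
    refine (norm_le_integral_norm_deriv (hd 0 (by omega)) (hc 1 (by omega)) hP c ?_).trans ?_
    · rw [← (hper 0 (by omega)).intervalIntegral_add_eq 0 c, hmean]
    · refine (intervalIntegral.integral_mono_on (by linarith)
        ((hc 1 (by omega)).norm.intervalIntegrable _ _) intervalIntegrable_const
        fun x _ => h1 x).trans ?_
      rw [intervalIntegral.integral_const, add_sub_cancel_left, smul_eq_mul, pow_succ']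
      exact (mul_assoc _ _ _).ge

section Torus

variable {E : Type*} [NormedAddCommGroup E] [NormedSpace ℝ E]

lemma integral_comp_add_of_periodic {ψ : ℝ → E} (hψ : Function.Periodic ψ 1) (d : ℝ) :
    ∫ x in (0 : ℝ)..1, ψ (x + d) = ∫ x in (0 : ℝ)..1, ψ x := by
  have h := hψ.intervalIntegral_add_eq d 0
  rw [intervalIntegral.integral_comp_add_right, zero_add, add_comm 1 d, h, zero_add]

lemma integral_comp_add_int_mul {ψ : ℝ → E} (hψ : Continuous ψ) (hper : Function.Periodic ψ 1)
    (q : ℝ) {a : ℤ} (ha : a ≠ 0) :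
    ∫ t in (0 : ℝ)..1, ψ (q + a * t) = ∫ t in (0 : ℝ)..1, ψ t := by
  have ha' : (a : ℝ) ≠ 0 := by exact_mod_cast ha
  have h := hper.intervalIntegral_add_zsmul_eq a q fun _ _ => hψ.intervalIntegrable _ _
  have h0 := hper.intervalIntegral_add_eq q 0
  rw [zsmul_one] at h
  rw [zero_add] at h0
  simp_rw [add_comm q]
  rw [intervalIntegral.integral_comp_mul_add _ ha', mul_zero, mul_one, zero_add, add_comm _ q, h,
    h0, ← Int.cast_smul_eq_zsmul ℝ, smul_smul, inv_mul_cancel₀ ha', one_smul]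

variable {g : ℝ × ℝ → E}

lemma integral_comp_add_torus (hper : ∀ x y : ℝ, g (x + 1, y) = g (x, y) ∧ g (x, y + 1) = g (x, y))
    (α β : ℝ) :
    ∫ x in (0 : ℝ)..1, ∫ y in (0 : ℝ)..1, g (x + α, y + β) =
      ∫ x in (0 : ℝ)..1, ∫ y in (0 : ℝ)..1, g (x, y) := by
  have hy : ∀ x, ∫ y in (0 : ℝ)..1, g (x, y + β) = ∫ y in (0 : ℝ)..1, g (x, y) :=
    fun x => integral_comp_add_of_periodic (ψ := fun y => g (x, y)) (fun y => (hper x y).2) β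
  simp only [hy]
  refine integral_comp_add_of_periodic (ψ := fun x => ∫ y in (0 : ℝ)..1, g (x, y))
    (fun x => ?_) α
  simp only [(hper x _).1]

lemma integral_geodesics_eq (hg : Continuous g)
    (hper : ∀ x y : ℝ, g (x + 1, y) = g (x, y) ∧ g (x, y + 1) = g (x, y))
    (q : ℝ) {a : ℤ} (ha : a ≠ 0) (b : ℤ) :
    ∫ c in (0 : ℝ)..1, ∫ t in (0 : ℝ)..1, g (q + a * t, c + b * t) =
      ∫ x in (0 : ℝ)..1, ∫ y in (0 : ℝ)..1, g (x, y) := by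
  rw [integral_integral_swap_of_continuous (by unfold Function.uncurry; fun_prop)]
  have hy : ∀ x β, ∫ y in (0 : ℝ)..1, g (x, y + β) = ∫ y in (0 : ℝ)..1, g (x, y) := fun x β =>
    integral_comp_add_of_periodic (ψ := fun y => g (x, y)) (fun y => (hper x y).2) β
  simp only [hy]
  refine integral_comp_add_int_mul (ψ := fun x => ∫ y in (0 : ℝ)..1, g (x, y)) (by fun_prop)
    (fun x => ?_) q ha
  simp only [(hper x _).1]

end Torus

lemma Periodic2.add_int {G : ℝ × ℝ → ℂ} (hG : Periodic2 G) (x y : ℝ) (u v : ℤ) :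
    G (x + u, y + v) = G (x, y) := by
  have hx : Function.Periodic (fun x => G (x, y + v)) 1 := fun x => (hG x _).1
  have hy : Function.Periodic (fun y => G (x, y)) 1 := fun y => (hG x y).2
  have h1 := hx.int_mul u x
  have h2 := hy.int_mul v y
  simp only [mul_one] at h1 h2
  rw [h1, h2]

lemma continuous_geodAvgP {G : ℝ × ℝ → ℂ} (hG : Continuous G) (a b : ℤ) :
    Continuous (geodAvgP G a b) := by
  unfold geodAvgP
  fun_prop

lemma geodAvgP_add_inv {G : ℝ × ℝ → ℂ} (hG : Periodic2 G) {a b : ℤ} (ha : a ≠ 0)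
    (hab : Int.gcd a b = 1) (q c : ℝ) :
    geodAvgP G a b (q, c + (a : ℝ)⁻¹) = geodAvgP G a b (q, c) := by
  have ha' : (a : ℝ) ≠ 0 := by exact_mod_cast ha
  obtain ⟨u, v, huv⟩ := Int.isCoprime_iff_gcd_eq_one.2 hab
  have huv' : (u : ℝ) * a + v * b = 1 := by exact_mod_cast huv
  have hper : Function.Periodic (fun t : ℝ => G (q + a * t, c + b * t)) 1 := by
    intro t
    simp only
    rw [← hG.add_int (q + a * t) (c + b * t) a b]
    congr 2 <;> ring
  simp only [geodAvgP]
  rw [← integral_comp_add_of_periodic hper (v / a)]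
  refine intervalIntegral.integral_congr fun t _ => ?_
  rw [← hG.add_int (q + a * t) (c + (a : ℝ)⁻¹ + b * t) v (-u)]
  congr 2
  · field_simp
    ring
  · push_cast
    field_simp
    linear_combination -huv'

lemma contDiff_iterate_pd2 {F : ℝ × ℝ → ℂ} {s : ℕ} (hF : ContDiff ℝ s F) :
    ∀ j ≤ s, ContDiff ℝ (s - j : ℕ) (pd2^[j] F) := by
  intro j
  induction j with
  | zero => simpa using hF
  | succ j ih =>
    intro hj
    rw [Function.iterate_succ_apply']
    refine contDiff_pd2 ?_
    rw [show s - (j + 1) + 1 = s - j by omega]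
    exact ih (by omega)

lemma Periodic2.iterate_pd2 {F : ℝ × ℝ → ℂ} (hF : Periodic2 F) (j : ℕ) :
    Periodic2 (_root_.pd2^[j] F) := by
  induction j with
  | zero => exact hF
  | succ j ih =>
    rw [Function.iterate_succ_apply']
    exact ih.pd2

/-- The averages along geodesics of direction `(a, b)` are small when `a` is large. -/
lemma norm_geodAvgP_mul_pow_le {F : ℝ × ℝ → ℂ} {s : ℕ} (hs : 1 ≤ s) (hper : Periodic2 F)
    (hF : ContDiff ℝ s F) (hmean : ∫ x in (0 : ℝ)..1, ∫ y in (0 : ℝ)..1, F (x, y) = 0)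
    {a b : ℤ} (ha : a ≠ 0) (hab : Int.gcd a b = 1) (p : ℝ × ℝ) :
    ‖geodAvgP F a b p‖ * |(a : ℝ)| ^ s ≤ L1norm (pdMix 0 s F) := by
  obtain ⟨n, rfl⟩ : ∃ n, s = n + 1 := ⟨s - 1, by omega⟩
  obtain ⟨q, c⟩ := p
  have ha' : (a : ℝ) ≠ 0 := by exact_mod_cast ha
  have hA : 0 < |(a : ℝ)| := abs_pos.2 ha'
  set H : ℕ → ℝ → ℂ := fun j c => geodAvgP (pd2^[j] F) a b (q, c)
  have hG : ∀ j ≤ n + 1, Continuous (pd2^[j] F) := fun j hj =>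
    (contDiff_iterate_pd2 hF j hj).continuous
  have hHc : ∀ j ≤ n + 1, Continuous (H j) := fun j hj =>
    (continuous_geodAvgP (hG j hj) a b).comp (by fun_prop)
  have hHper : ∀ j, Function.Periodic (H j) |(a : ℝ)|⁻¹ := by
    intro j
    have h : Function.Periodic (H j) (a : ℝ)⁻¹ :=
      fun c => geodAvgP_add_inv (hper.iterate_pd2 j) ha hab q c
    rw [← abs_inv]
    rcases abs_choice (a : ℝ)⁻¹ with h' | h' <;> rw [h']
    exacts [h, h.neg]
  have hHd : ∀ j ≤ n, ∀ x, HasDerivAt (H j) (H (j + 1) x) x := by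
    intro j hj x
    have h0 := hG j (by omega)
    have h1 := hG (j + 1) (by omega)
    refine hasDerivAt_integral_of_continuous
      (Φ := fun c t => (pd2^[j] F) (q + a * t, c + b * t))
      (Φ' := fun c t => (pd2^[j + 1] F) (q + a * t, c + b * t))
      (by unfold Function.uncurry; fun_prop) (by unfold Function.uncurry; fun_prop) ?_ x
    intro t c
    rw [Function.iterate_succ_apply']
    exact (hasDerivAt_pd2 ((contDiff_iterate_pd2 hF j (by omega)).differentiable
      (by exact_mod_cast (by omega : n + 1 - j ≠ 0))) (q + a * t) (c + b * t)).comp_add_const c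
        (b * t)
  have hfull : ∀ {E : Type} [NormedAddCommGroup E] [NormedSpace ℝ E] {ψ : ℝ → E}, Continuous ψ →
      Function.Periodic ψ |(a : ℝ)|⁻¹ →
      ∫ c in (0 : ℝ)..1, ψ c = |(a : ℝ)| • ∫ c in (0 : ℝ)..0 + |(a : ℝ)|⁻¹, ψ c := by
    intro E _ _ ψ hψ hψper
    have h := hψper.intervalIntegral_add_zsmul_eq |a| 0 fun _ _ => hψ.intervalIntegrable _ _
    rwa [← Int.cast_smul_eq_zsmul ℝ, ← Int.cast_smul_eq_zsmul ℝ, Int.cast_abs, smul_eq_mul,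
      mul_inv_cancel₀ hA.ne', zero_add] at h
  have hH0 : ∫ c in (0 : ℝ)..0 + |(a : ℝ)|⁻¹, H 0 c = 0 := by
    have h := hfull (hHc 0 (by omega)) (hHper 0)
    have h' := integral_geodesics_eq (hG 0 (by omega)) (hper.iterate_pd2 0) q ha b
    simp only [Function.iterate_zero, id] at h'
    rw [hmean] at h'
    have h'' : ∫ c in (0 : ℝ)..1, H 0 c = 0 := h'
    rw [h''] at h
    exact (smul_eq_zero.1 h.symm).resolve_left hA.ne'
  have hHs : |(a : ℝ)| * ∫ c in (0 : ℝ)..0 + |(a : ℝ)|⁻¹, ‖H (n + 1) c‖ ≤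
      L1norm (pdMix 0 (n + 1) F) := by
    have hGs := hG (n + 1) le_rfl
    rw [← smul_eq_mul, ← hfull (hHc (n + 1) le_rfl).norm
      (fun x => by simp only [hHper (n + 1) x])]
    change _ ≤ L1norm (pd2^[n + 1] F)
    rw [L1norm, ← integral_geodesics_eq (g := fun v => ‖(pd2^[n + 1] F) v‖) (by fun_prop)
      (fun x y => by simp only [hper.iterate_pd2 (n + 1) x y, and_self]) q ha b]
    exact intervalIntegral.integral_mono_on zero_le_one
      ((hHc (n + 1) le_rfl).norm.intervalIntegrable _ _)
      (Continuous.intervalIntegrable (by fun_prop) _ _)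
      fun c _ => intervalIntegral.norm_integral_le_integral_norm zero_le_one
  calc ‖geodAvgP F a b (q, c)‖ * |(a : ℝ)| ^ (n + 1)
      ≤ (|(a : ℝ)|⁻¹ ^ n * ∫ c in (0 : ℝ)..0 + |(a : ℝ)|⁻¹, ‖H (n + 1) c‖) *
          |(a : ℝ)| ^ (n + 1) := by
        gcongr
        exact norm_le_pow_mul_integral_norm_iterated_deriv (inv_pos.2 hA) n H hHd hHc
          (fun j _ => hHper j) hH0 c
    _ = |(a : ℝ)| * ∫ c in (0 : ℝ)..0 + |(a : ℝ)|⁻¹, ‖H (n + 1) c‖ := by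
        rw [inv_pow]
        field_simp
        ring
    _ ≤ _ := hHs

lemma pdMix_zero_eq_swap (F : ℝ × ℝ → ℂ) (s : ℕ) :
    pdMix s 0 F = pd2^[s] (F ∘ Prod.swap) ∘ Prod.swap := by
  simp only [pdMix, Function.iterate_zero, id]
  induction s with
  | zero => rfl
  | succ s ih =>
    rw [Function.iterate_succ_apply', Function.iterate_succ_apply', ih]
    rfl

/-- The averages along geodesics of direction `(a, b)` are small when `b` is large. -/
lemma norm_geodAvgP_mul_pow_le' {F : ℝ × ℝ → ℂ} {s : ℕ} (hs : 1 ≤ s) (hper : Periodic2 F)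
    (hF : ContDiff ℝ s F) (hmean : ∫ x in (0 : ℝ)..1, ∫ y in (0 : ℝ)..1, F (x, y) = 0)
    {a b : ℤ} (hb : b ≠ 0) (hab : Int.gcd a b = 1) (p : ℝ × ℝ) :
    ‖geodAvgP F a b p‖ * |(b : ℝ)| ^ s ≤ L1norm (pdMix s 0 F) := by
  have hFc := hF.continuous
  have hF' : ContDiff ℝ s (F ∘ Prod.swap) := hF.comp_swap
  have hG : Continuous (pd2^[s] (F ∘ Prod.swap)) :=
    (contDiff_iterate_pd2 hF' s le_rfl).continuous
  have h := norm_geodAvgP_mul_pow_le hs hper.swap hF' (by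
    rw [← hmean]
    exact integral_integral_swap_of_continuous (Φ := fun x y => F (y, x))
      (by unfold Function.uncurry; fun_prop) 0 1 0 1) hb (by rwa [Int.gcd_comm]) p.swap
  refine h.trans (le_of_eq ?_)
  rw [pdMix_zero_eq_swap]
  exact integral_integral_swap_of_continuous
    (Φ := fun x y => ‖pd2^[s] (F ∘ Prod.swap) (x, y)‖) (by unfold Function.uncurry; fun_prop)
    0 1 0 1

/-- The Fourier coefficients of `F` orthogonal to `(a, b)` are bounded by the averages of `F`
along the geodesics of direction `(a, b)`. -/
lemma norm_fc_le_of_geodAvgP_le {F : ℝ × ℝ → ℂ} (hper : Periodic2 F) (hF : Continuous F)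
    {a b n m : ℤ} (hort : n * a + m * b = 0) {S : ℝ} (hS : ∀ p, ‖geodAvgP F a b p‖ ≤ S) :
    ‖fc F (n, m)‖ ≤ S := by
  have hort' : (n : ℂ) * a + m * b = 0 := by exact_mod_cast hort
  have hn := continuous_expNeg n
  have hm := continuous_expNeg m
  set Ψ : ℝ × ℝ → ℂ := fun v => F v * (expNeg n v.1 * expNeg m v.2) with hΨ
  have hΨper : Periodic2 Ψ := fun x y => by
    simp only [hΨ, (hper x y).1, (hper x y).2, expNeg_add, expNeg_one, mul_one, and_self]
  have hfc : fc F (n, m) = ∫ x in (0 : ℝ)..1, ∫ y in (0 : ℝ)..1, Ψ (x, y) := by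
    simp only [fc, hΨ, expNeg, mul_add, Complex.exp_add]
  have hinv : ∀ t : ℝ, expNeg n (a * t) * expNeg m (b * t) = 1 := by
    intro t
    rw [expNeg, expNeg, ← Complex.exp_add, Complex.exp_eq_one_iff]
    refine ⟨0, ?_⟩
    push_cast
    linear_combination (-2 * (Real.pi : ℂ) * Complex.I * t) * hort'
  have havg : fc F (n, m) = ∫ x in (0 : ℝ)..1, ∫ y in (0 : ℝ)..1,
      geodAvgP F a b (x, y) * (expNeg n x * expNeg m y) := by
    calc fc F (n, m) = ∫ t in (0 : ℝ)..1, ∫ x in (0 : ℝ)..1, ∫ y in (0 : ℝ)..1,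
          Ψ (x + a * t, y + b * t) := by
          simp only [integral_comp_add_torus hΨper, ← hfc, intervalIntegral.integral_const,
            sub_zero, one_smul]
      _ = ∫ x in (0 : ℝ)..1, ∫ t in (0 : ℝ)..1, ∫ y in (0 : ℝ)..1,
          Ψ (x + a * t, y + b * t) :=
          integral_integral_swap_of_continuous (by unfold Function.uncurry; fun_prop) 0 1 0 1
      _ = ∫ x in (0 : ℝ)..1, ∫ y in (0 : ℝ)..1, ∫ t in (0 : ℝ)..1,
          Ψ (x + a * t, y + b * t) :=
          intervalIntegral.integral_congr fun x _ =>
            integral_integral_swap_of_continuous (by unfold Function.uncurry; fun_prop) 0 1 0 1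
      _ = _ := by
          refine intervalIntegral.integral_congr fun x _ =>
            intervalIntegral.integral_congr fun y _ => ?_
          simp only [geodAvgP, ← intervalIntegral.integral_mul_const]
          refine intervalIntegral.integral_congr fun t _ => ?_
          simp only [hΨ, expNeg_add]
          linear_combination (F (x + a * t, y + b * t) * expNeg n x * expNeg m y) * hinv t
  rw [havg]
  refine (intervalIntegral.norm_integral_le_of_norm_le_const fun x _ =>
    intervalIntegral.norm_integral_le_of_norm_le_const fun y _ => ?_).trans_eq
      (b := S * |(1 : ℝ) - 0| * |(1 : ℝ) - 0|) (by simp)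
  simpa only [norm_mul, norm_expNeg, mul_one] using hS (x, y)

/-- A function on the torus with mean zero is controlled by its gradient and by a uniform bound for
its averages over closed geodesics. -/
lemma L2sq_le_of_geodAvgP_le {F : ℝ × ℝ → ℂ} (hper : Periodic2 F) (hF : ContDiff ℝ 1 F)
    (hmean : ∫ x in (0 : ℝ)..1, ∫ y in (0 : ℝ)..1, F (x, y) = 0) {S : ℝ}
    (hS : ∀ a b p, Int.gcd a b = 1 → ‖geodAvgP F a b p‖ ≤ S) (N : ℕ) :
    L2sq F ≤ 8 * N ^ 2 * S ^ 2 + (4 * Real.pi ^ 2 * (N + 1) ^ 2)⁻¹ * gradL2sq F := by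
  have hfc0 : fc F (0, 0) = 0 := by simpa [fc] using hmean
  have hfc : ∀ n m : ℤ, (n, m) ≠ 0 → ‖fc F (n, m)‖ ≤ S := by
    intro n m hnm
    have hg : Int.gcd n m ≠ 0 := by
      rw [Ne, Int.gcd_eq_zero_iff]
      simpa [Prod.ext_iff] using hnm
    obtain ⟨n', m', hco, hn, hm⟩ := Int.exists_gcd_one (Nat.pos_of_ne_zero hg)
    refine norm_fc_le_of_geodAvgP_le hper hF.continuous (a := m') (b := -n') ?_
      fun p => hS _ _ p (by rw [Int.gcd_neg, Int.gcd_comm]; exact hco)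
    linear_combination m' * hn - n' * hm
  refine (L2sq_le_sum_add hper hF N).trans (add_le_add_left ?_ _)
  rw [Finset.sum_comm, ← Finset.sum_product', ← Finset.sum_erase (a := (0, 0)) _ (by simp [hfc0])]
  refine (Finset.sum_le_card_nsmul _ _ (S ^ 2) fun k hk => ?_).trans ?_
  · have := hfc k.1 k.2 (Finset.ne_of_mem_erase hk)
    gcongr
  · have hcard : ((Finset.Icc (-(N : ℤ)) N ×ˢ Finset.Icc (-(N : ℤ)) N).erase (0, 0)).card ≤
        8 * N ^ 2 := by
      rw [Finset.card_erase_of_mem (by simp), Finset.card_product, Int.card_Icc,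
        show ((N : ℤ) + 1 - -(N : ℤ)).toNat = 2 * N + 1 by omega]
      have : N ≤ N ^ 2 := Nat.le_self_pow two_ne_zero N
      rw [Nat.sub_le_iff_le_add]
      nlinarith
    rw [nsmul_eq_mul]
    gcongr
    exact_mod_cast hcard

/-- The averages over closed geodesics decay with the length of the geodesic. -/
lemma norm_geodAvgP_mul_length_pow_le {F : ℝ × ℝ → ℂ} {s : ℕ} (hs : 1 ≤ s) (hper : Periodic2 F)
    (hF : ContDiff ℝ s F) (hmean : ∫ x in (0 : ℝ)..1, ∫ y in (0 : ℝ)..1, F (x, y) = 0)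
    {M : ℝ} (hM : ∀ a1 a2 : ℕ, a1 + a2 = s → L1norm (pdMix a1 a2 F) ≤ M)
    {a b : ℤ} (hab : Int.gcd a b = 1) (p : ℝ × ℝ) :
    ‖geodAvgP F a b p‖ * √((a : ℝ) ^ 2 + (b : ℝ) ^ 2) ^ s ≤ √2 ^ s * M := by
  have key : ∀ {x y : ℝ}, |y| ≤ |x| → ‖geodAvgP F a b p‖ * |x| ^ s ≤ M →
      ‖geodAvgP F a b p‖ * √(x ^ 2 + y ^ 2) ^ s ≤ √2 ^ s * M := by
    intro x y hxy h
    calc ‖geodAvgP F a b p‖ * √(x ^ 2 + y ^ 2) ^ s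
        ≤ ‖geodAvgP F a b p‖ * (√2 * |x|) ^ s := by
          gcongr
          rw [← Real.sqrt_sq_eq_abs, ← Real.sqrt_mul zero_le_two]
          exact Real.sqrt_le_sqrt (by linarith [sq_le_sq.2 hxy])
      _ = √2 ^ s * (‖geodAvgP F a b p‖ * |x| ^ s) := by ring
      _ ≤ √2 ^ s * M := by gcongr
  rcases le_total |(b : ℝ)| |(a : ℝ)| with h | h
  · have ha : a ≠ 0 := by
      rintro rfl
      have hb : b = 0 := by simpa using h
      simp [hb] at hab
    exact key h ((norm_geodAvgP_mul_pow_le hs hper hF hmean ha hab p).trans (hM 0 s (zero_add s)))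
  · have hb : b ≠ 0 := by
      rintro rfl
      have ha : a = 0 := by simpa using h
      simp [ha] at hab
    rw [add_comm]
    exact key h ((norm_geodAvgP_mul_pow_le' hs hper hF hmean hb hab p).trans (hM s 0 (add_zero s)))

lemma one_le_length {a b : ℤ} (hab : Int.gcd a b = 1) : 1 ≤ √((a : ℝ) ^ 2 + (b : ℝ) ^ 2) := by
  rw [Real.one_le_sqrt]
  have : 1 ≤ a ^ 2 + b ^ 2 := by
    by_contra! h
    have ha : a = 0 := by nlinarith [sq_nonneg a, sq_nonneg b]
    have hb : b = 0 := by nlinarith [sq_nonneg a, sq_nonneg b]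
    simp [ha, hb] at hab
  exact_mod_cast this

lemma exists_isGreatest_geodVals {F : ℝ × ℝ → ℂ} (hper : Periodic2 F) (hF : Continuous F)
    {s : ℕ} (hs : 1 ≤ s) {B : ℝ} (hB : ∀ (a b : ℤ) (p : ℝ × ℝ), Int.gcd a b = 1 →
      ‖geodAvgP F a b p‖ * √((a : ℝ) ^ 2 + (b : ℝ) ^ 2) ^ s ≤ B)
    (hpos : ∃ v ∈ geodVals F, 0 < v) : ∃ v, IsGreatest (geodVals F) v := by
  obtain ⟨v₀, hv₀, hv₀pos⟩ := hpos
  set D : Set (ℤ × ℤ) := {k | Int.gcd k.1 k.2 = 1 ∧ |(k.1 : ℝ)| ≤ B / v₀ ∧ |(k.2 : ℝ)| ≤ B / v₀}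
  have hD : D.Finite := by
    refine (Set.finite_Icc ((-⌊B / v₀⌋, -⌊B / v₀⌋) : ℤ × ℤ) (⌊B / v₀⌋, ⌊B / v₀⌋)).subset ?_
    rintro ⟨a, b⟩ ⟨-, ha, hb⟩
    have ha' : |a| ≤ ⌊B / v₀⌋ := Int.le_floor.2 (by exact_mod_cast ha)
    have hb' : |b| ≤ ⌊B / v₀⌋ := Int.le_floor.2 (by exact_mod_cast hb)
    rw [abs_le] at ha' hb'
    exact ⟨⟨ha'.1, hb'.1⟩, ⟨ha'.2, hb'.2⟩⟩
  set K : Set ℝ := ⋃ k ∈ D, (fun p => ‖geodAvgP F k.1 k.2 p‖) '' Set.Icc (0 : ℝ × ℝ) 1 with hKdef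
  have hK : IsCompact K := hD.isCompact_biUnion fun k _ =>
    isCompact_Icc.image (continuous_geodAvgP hF k.1 k.2).norm
  have hKsub : K ⊆ geodVals F := by
    intro v hv
    simp only [hKdef, Set.mem_iUnion₂] at hv
    obtain ⟨k, hk, p, -, rfl⟩ := hv
    exact ⟨k.1, k.2, p, hk.1, rfl⟩
  have hlarge : ∀ v ∈ geodVals F, v₀ ≤ v → v ∈ K := by
    rintro v ⟨a, b, p, hab, rfl⟩ hv
    set L := √((a : ℝ) ^ 2 + (b : ℝ) ^ 2)
    have hL1 : 1 ≤ L := one_le_length hab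
    have hLB : L ≤ B / v₀ := by
      rw [le_div_iff₀' hv₀pos]
      calc v₀ * L ≤ ‖geodAvgP F a b p‖ * L ^ s := by
            gcongr
            exact le_self_pow₀ hL1 (by omega)
        _ ≤ B := hB a b p hab
    refine Set.mem_iUnion₂.2 ⟨(a, b), ⟨hab, ?_, ?_⟩, (Int.fract p.1, Int.fract p.2), ?_, ?_⟩
    · exact (Real.abs_le_sqrt (by simp [sq_nonneg])).trans hLB
    · exact (Real.abs_le_sqrt (by simp [sq_nonneg])).trans hLB
    · exact ⟨⟨Int.fract_nonneg _, Int.fract_nonneg _⟩,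
        ⟨(Int.fract_lt_one _).le, (Int.fract_lt_one _).le⟩⟩
    · simp only [geodAvgP]
      congr 1
      refine intervalIntegral.integral_congr fun t _ => ?_
      simp only [← hper.add_int (Int.fract p.1 + a * t) (Int.fract p.2 + b * t) ⌊p.1⌋ ⌊p.2⌋]
      congr 2
      · linarith [Int.fract_add_floor p.1]
      · linarith [Int.fract_add_floor p.2]
  obtain ⟨v, hvK, hv⟩ := hK.exists_isGreatest ⟨v₀, hlarge v₀ hv₀ le_rfl⟩
  refine ⟨v, hKsub hvK, fun w hw => ?_⟩
  rcases le_total v₀ w with h | h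
  · exact hv (hlarge w hw h)
  · exact h.trans (hv (hlarge v₀ hv₀ le_rfl))

lemma gradL2sq_nonneg (F : ℝ × ℝ → ℂ) : 0 ≤ gradL2sq F :=
  intervalIntegral.integral_nonneg zero_le_one fun _ _ =>
    intervalIntegral.integral_nonneg zero_le_one fun _ _ => by positivity

lemma L2sq_pos {F : ℝ × ℝ → ℂ} (hper : Periodic2 F) (hF : Continuous F) (hne : ∃ v, F v ≠ 0) :
    0 < L2sq F := by
  obtain ⟨⟨x₀, y₀⟩, hv⟩ := hne
  have h := integral_comp_add_torus (g := fun v => ‖F v‖ ^ 2)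
    (fun x y => by simp only [hper x y, and_self]) x₀ y₀
  rw [L2sq, ← h]
  have hrow : Continuous fun x => ∫ y in (0 : ℝ)..1, ‖F (x + x₀, y + y₀)‖ ^ 2 := by fun_prop
  have hin : ∀ x, 0 ≤ ∫ y in (0 : ℝ)..1, ‖F (x + x₀, y + y₀)‖ ^ 2 := fun x =>
    intervalIntegral.integral_nonneg zero_le_one fun _ _ => by positivity
  refine intervalIntegral.integral_pos zero_lt_one hrow.continuousOn (fun x _ => hin x)
    ⟨0, by simp, ?_⟩
  refine intervalIntegral.integral_pos zero_lt_one
    (Continuous.continuousOn (by fun_prop)) (fun y _ => by positivity) ⟨0, by simp, ?_⟩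
  rw [zero_add, zero_add]
  exact pow_pos (norm_pos_iff.2 hv) 2

/-- Some average is nonzero, unless the function vanishes. -/
lemma exists_geodVals_pos {F : ℝ × ℝ → ℂ} (hper : Periodic2 F) (hF : ContDiff ℝ 1 F)
    (hmean : ∫ x in (0 : ℝ)..1, ∫ y in (0 : ℝ)..1, F (x, y) = 0) (hne : ∃ v, F v ≠ 0) :
    ∃ v ∈ geodVals F, 0 < v := by
  by_contra! h
  have hL := L2sq_pos hper hF.continuous hne
  have hG := gradL2sq_nonneg F
  have hbound := L2sq_le_of_geodAvgP_le hper hF hmean (S := 0)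
    fun a b p hab => h _ ⟨a, b, p, hab, rfl⟩
  obtain ⟨N, hN⟩ := exists_nat_gt (gradL2sq F / L2sq F)
  have hN' := hbound N
  rw [div_lt_iff₀ hL] at hN
  have hpi : 1 ≤ 4 * Real.pi ^ 2 := by nlinarith [Real.pi_gt_three]
  rw [zero_pow two_ne_zero, mul_zero, zero_add, inv_mul_eq_div, le_div_iff₀ (by positivity)] at hN'
  have : (N : ℝ) ≤ 4 * Real.pi ^ 2 * (N + 1) ^ 2 := by
    nlinarith [sq_nonneg (N : ℝ), mul_le_mul_of_nonneg_right hpi (sq_nonneg ((N : ℝ) + 1)),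
      Nat.cast_nonneg (α := ℝ) N]
  nlinarith

/-- A function on the torus with mean zero has a large average over some closed geodesic. -/
lemma L2sq_le_mul_sqrt_gradL2sq {F : ℝ × ℝ → ℂ} (hper : Periodic2 F) (hF : ContDiff ℝ 1 F)
    (hmean : ∫ x in (0 : ℝ)..1, ∫ y in (0 : ℝ)..1, F (x, y) = 0) {S : ℝ} (hSpos : 0 < S)
    (hS : ∀ a b p, Int.gcd a b = 1 → ‖geodAvgP F a b p‖ ≤ S) :
    L2sq F ≤ 9 * √(gradL2sq F) * S := by
  set g := √(gradL2sq F)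
  have hg0 : 0 ≤ g := Real.sqrt_nonneg _
  have hgsq : gradL2sq F = g ^ 2 := (Real.sq_sqrt (gradL2sq_nonneg F)).symm
  set K := √(g / S) with hKdef
  have hK : K ^ 2 = g / S := Real.sq_sqrt (by positivity)
  have hK0 : 0 ≤ K := Real.sqrt_nonneg _
  have hKS : K ^ 2 * S = g := by rw [hK, div_mul_cancel₀ _ hSpos.ne']
  have hlow : (⌊K⌋₊ : ℝ) ^ 2 * S ≤ g := by
    rw [← hKS]
    gcongr
    exact Nat.floor_le hK0
  have hhigh : g ≤ (⌊K⌋₊ + 1 : ℝ) ^ 2 * S := by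
    rw [← hKS]
    gcongr
    exact (Nat.lt_floor_add_one K).le
  have hpi : 1 ≤ 4 * Real.pi ^ 2 := by nlinarith [Real.pi_gt_three]
  have htail : (4 * Real.pi ^ 2 * (⌊K⌋₊ + 1 : ℝ) ^ 2)⁻¹ * gradL2sq F ≤ g * S := by
    rw [inv_mul_eq_div, div_le_iff₀ (by positivity), hgsq]
    calc g ^ 2 = 1 * (g * g) := by ring
      _ ≤ 4 * Real.pi ^ 2 * (g * ((⌊K⌋₊ + 1 : ℝ) ^ 2 * S)) := by gcongr
      _ = _ := by ring
  have := L2sq_le_of_geodAvgP_le hper hF hmean hS ⌊K⌋₊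
  nlinarith

/-- main theorem: for real `f ∈ C^s(T²)`, `s ≥ 2`, with mean zero and `f ≠ 0`,
the supremum over closed geodesics of `(1/|γ|)|∫_γ f|` is attained, and any attaining geodesic
satisfies `|γ|^s ≤ C_s (max_{|α|=s}‖∂_α f‖_{L¹}) ‖∇f‖_{L²} ‖f‖_{L²}^{-2}`. -/
theorem stmt11 (s : ℕ) (hs : 2 ≤ s) :
    ∃ C : ℝ, 0 < C ∧
      ∀ (f : ℝ × ℝ → ℝ), Periodic2 (fun v => (f v : ℂ)) → ContDiff ℝ s f →
        (∫ x in (0:ℝ)..1, ∫ y in (0:ℝ)..1, f (x, y)) = 0 →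
        (∃ v, f v ≠ 0) →
        ∀ M : ℝ,
          (∀ a1 a2 : ℕ, a1 + a2 = s → L1norm (pdMix a1 a2 (fun v => (f v : ℂ))) ≤ M) →
          (∃ (a b : ℤ) (p : ℝ × ℝ), Int.gcd a b = 1 ∧
              ‖geodAvgP (fun v => (f v : ℂ)) a b p‖ = sSup (geodVals (fun v => (f v : ℂ)))) ∧
          ∀ (a b : ℤ) (p : ℝ × ℝ), Int.gcd a b = 1 →
            ‖geodAvgP (fun v => (f v : ℂ)) a b p‖ = sSup (geodVals (fun v => (f v : ℂ))) →
            Real.sqrt ((a : ℝ) ^ 2 + (b : ℝ) ^ 2) ^ s ≤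
              C * M * Real.sqrt (gradL2sq (fun v => (f v : ℂ))) /
                L2sq (fun v => (f v : ℂ)) := by
  refine ⟨9 * √2 ^ s, by positivity, fun f hper hf hmean hne M hM => ?_⟩
  set F : ℝ × ℝ → ℂ := fun v => (f v : ℂ) with hFdef
  have hF : ContDiff ℝ s F := Complex.ofRealCLM.contDiff.comp hf
  have hF1 : ContDiff ℝ 1 F := hF.of_le (by exact_mod_cast (by omega : 1 ≤ s))
  have hmeanF : ∫ x in (0 : ℝ)..1, ∫ y in (0 : ℝ)..1, F (x, y) = 0 := by
    simp only [hFdef, intervalIntegral.integral_ofReal, hmean, Complex.ofReal_zero]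
  have hneF : ∃ v, F v ≠ 0 := by simpa [hFdef] using hne
  have hbound := fun (a b : ℤ) (p : ℝ × ℝ) (hab : Int.gcd a b = 1) =>
    norm_geodAvgP_mul_length_pow_le (by omega) hper hF hmeanF hM hab p
  have hpos := exists_geodVals_pos hper hF1 hmeanF hneF
  obtain ⟨S, hS⟩ := exists_isGreatest_geodVals hper hF.continuous (by omega) hbound hpos
  rw [hS.csSup_eq]
  obtain ⟨v, hv, hv0⟩ := hpos
  have hSpos : 0 < S := hv0.trans_le (hS.2 hv)
  constructor
  · obtain ⟨a, b, p, hab, h⟩ := hS.1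
    exact ⟨a, b, p, hab, h.symm⟩
  · intro a b p hab h
    have hL := L2sq_le_mul_sqrt_gradL2sq hper hF1 hmeanF hSpos
      fun a b p hab => hS.2 ⟨a, b, p, hab, rfl⟩
    have hM' := hbound a b p hab
    rw [h] at hM'
    rw [le_div_iff₀ (L2sq_pos hper hF.continuous hneF)]
    calc √((a : ℝ) ^ 2 + (b : ℝ) ^ 2) ^ s * L2sq F
        ≤ √((a : ℝ) ^ 2 + (b : ℝ) ^ 2) ^ s * (9 * √(gradL2sq F) * S) := by gcongr
      _ = 9 * √(gradL2sq F) * (S * √((a : ℝ) ^ 2 + (b : ℝ) ^ 2) ^ s) := by ring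
      _ ≤ 9 * √(gradL2sq F) * (√2 ^ s * M) := by gcongr
      _ = 9 * √2 ^ s * M * √(gradL2sq F) := by ring
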